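/- arXiv:2207.14443 — 2 statements merged into one kernel-verified Lean document; each statement's English description precedes it below -/
import Mathlib

section
/- Let n ≥ 1, K > 0, let x₁,…,x_m ∈ L^n_K, and let ω₁,…,ω_m be nonnegative reals with Σᵢωᵢ > 0. Then the weighted sum a = Σᵢ₌₁^m ωᵢxᵢ is a future-directed time-like vector: its 0-th coordinate a₀ is positive and ⟨a,a⟩_L ≤ −K(Σᵢωᵢ)² < 0. Consequently |‖a‖_L| > 0 and the normalized point √K · a / |‖a‖_L| lies on L^n_K. -/
open Finset

/-- The Lorentzian scalar product on `ℝ^{n+1}` (coordinates indexed `0, …, n`):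
`⟨x,y⟩_L = −x₀y₀ + ∑_{i=1}^n xᵢyᵢ`. -/
def lorentzInner {n : ℕ} (x y : Fin (n + 1) → ℝ) : ℝ :=
  -(x 0 * y 0) + ∑ i : Fin n, x i.succ * y i.succ

theorem lorentzInner_comm {n : ℕ} (x y : Fin (n + 1) → ℝ) :
    lorentzInner x y = lorentzInner y x := by
  simp only [lorentzInner, mul_comm]

theorem lorentzInner_smul_smul {n : ℕ} (c : ℝ) (x : Fin (n + 1) → ℝ) :
    lorentzInner (c • x) (c • x) = c ^ 2 * lorentzInner x x := by
  simp only [lorentzInner, Pi.smul_apply, smul_eq_mul, mul_add, Finset.mul_sum]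
  congr 1
  · ring
  · exact Finset.sum_congr rfl fun i _ => by ring

theorem lorentzInner_sum_smul_left {n : ℕ} {ι : Type*} (s : Finset ι) (c : ι → ℝ)
    (x : ι → Fin (n + 1) → ℝ) (y : Fin (n + 1) → ℝ) :
    lorentzInner (∑ i ∈ s, c i • x i) y = ∑ i ∈ s, c i * lorentzInner (x i) y := by
  simp only [lorentzInner, Finset.sum_apply, Pi.smul_apply, smul_eq_mul, Finset.sum_mul,
    mul_add, Finset.mul_sum, Finset.sum_add_distrib, mul_neg, Finset.sum_neg_distrib, mul_assoc]
  rw [Finset.sum_comm]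

/-- The reverse Cauchy–Schwarz inequality for two points of the hyperboloid. -/
theorem lorentzInner_le_neg {n : ℕ} {K : ℝ} (hK : 0 ≤ K) {x y : Fin (n + 1) → ℝ}
    (hx : lorentzInner x x = -K) (hy : lorentzInner y y = -K)
    (hx0 : 0 ≤ x 0) (hy0 : 0 ≤ y 0) : lorentzInner x y ≤ -K := by
  unfold lorentzInner at *
  have hcs := Finset.sum_mul_sq_le_sq_mul_sq Finset.univ
    (fun i : Fin n => x i.succ) (fun i => y i.succ)
  have hamgm : 2 * ∑ i : Fin n, x i.succ * y i.succ ≤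
      ∑ i : Fin n, x i.succ ^ 2 + ∑ i : Fin n, y i.succ ^ 2 := by
    rw [Finset.mul_sum, ← Finset.sum_add_distrib]
    exact Finset.sum_le_sum fun i _ => by
      rw [← mul_assoc]
      exact two_mul_le_add_sq _ _
  simp only [← pow_two] at hx hy
  have hx' : x 0 ^ 2 = K + ∑ i : Fin n, x i.succ ^ 2 := by linarith
  have hy' : y 0 ^ 2 = K + ∑ i : Fin n, y i.succ ^ 2 := by linarith
  have hsq : (K + ∑ i : Fin n, x i.succ * y i.succ) ^ 2 ≤ (x 0 * y 0) ^ 2 := by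
    rw [mul_pow, hx', hy']
    nlinarith [mul_le_mul_of_nonneg_left hamgm hK]
  linarith [(abs_le_of_sq_le_sq' hsq (mul_nonneg hx0 hy0)).2]

/-- **Weighted sums of hyperboloid points are future-directed time-like.**
If `x 1, …, x m` lie on the hyperboloid `L^n_K = {x : ⟨x,x⟩_L = −K, x₀ > 0}` (`K > 0`) and
`ω i ≥ 0` with `∑ ω i > 0`, then `a = ∑ ω i • x i` satisfies `a₀ > 0` and
`⟨a,a⟩_L ≤ −K (∑ ω i)² < 0`; hence `|‖a‖_L| = √(−⟨a,a⟩_L) > 0` and the normalized point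
`√K • a / |‖a‖_L|` lies on `L^n_K`. -/
theorem lorentz_weighted_sum_timelike {n : ℕ} (hn : 1 ≤ n) {K : ℝ} (hK : 0 < K)
    {m : ℕ} (x : Fin m → (Fin (n + 1) → ℝ)) (ω : Fin m → ℝ)
    (hx : ∀ i, lorentzInner (x i) (x i) = -K) (hx0 : ∀ i, 0 < x i 0)
    (hω : ∀ i, 0 ≤ ω i) (hsum : 0 < ∑ i, ω i) :
    (0 < (∑ i, ω i • x i) 0) ∧
    lorentzInner (∑ i, ω i • x i) (∑ i, ω i • x i) ≤ -K * (∑ i, ω i) ^ 2 ∧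
    -K * (∑ i, ω i) ^ 2 < 0 ∧
    0 < Real.sqrt (-(lorentzInner (∑ i, ω i • x i) (∑ i, ω i • x i))) ∧
    (lorentzInner
        ((Real.sqrt K / Real.sqrt (-(lorentzInner (∑ i, ω i • x i) (∑ i, ω i • x i)))) •
          ∑ i, ω i • x i)
        ((Real.sqrt K / Real.sqrt (-(lorentzInner (∑ i, ω i • x i) (∑ i, ω i • x i)))) •
          ∑ i, ω i • x i) = -K ∧
      0 < ((Real.sqrt K / Real.sqrt (-(lorentzInner (∑ i, ω i • x i) (∑ i, ω i • x i)))) •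
          ∑ i, ω i • x i) 0) := by
  set a := ∑ i, ω i • x i with ha
  have ha0 : 0 < a 0 := by
    obtain ⟨j, -, hj⟩ := Finset.exists_ne_zero_of_sum_ne_zero hsum.ne'
    simp only [ha, Finset.sum_apply, Pi.smul_apply, smul_eq_mul]
    exact Finset.sum_pos' (fun i _ => mul_nonneg (hω i) (hx0 i).le)
      ⟨j, Finset.mem_univ j, mul_pos ((hω j).lt_of_ne' hj) (hx0 j)⟩
  have hle : lorentzInner a a ≤ -K * (∑ i, ω i) ^ 2 := by
    calc lorentzInner a a = ∑ i, ω i * ∑ j, ω j * lorentzInner (x j) (x i) := by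
          rw [ha, lorentzInner_sum_smul_left]
          refine Finset.sum_congr rfl fun i _ => ?_
          rw [lorentzInner_comm, lorentzInner_sum_smul_left]
      _ ≤ ∑ i, ω i * ∑ j, ω j * -K := by
          gcongr with i _ j _
          · exact hω i
          · exact hω j
          · exact lorentzInner_le_neg hK.le (hx j) (hx i) (hx0 j).le (hx0 i).le
      _ = -K * (∑ i, ω i) ^ 2 := by
          rw [← Finset.sum_mul, ← Finset.sum_mul]
          ring
  have hneg : -K * (∑ i, ω i) ^ 2 < 0 := mul_neg_of_neg_of_pos (neg_neg_of_pos hK) (pow_pos hsum 2)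
  have hpos : 0 < -lorentzInner a a := by linarith
  have hsqrt := Real.sqrt_pos.2 hpos
  refine ⟨ha0, hle, hneg, hsqrt, ?_, mul_pos (div_pos (Real.sqrt_pos.2 hK) hsqrt) ha0⟩
  rw [lorentzInner_smul_smul, div_pow, Real.sq_sqrt hK.le, Real.sq_sqrt hpos.le]
  have := (neg_pos.1 hpos).ne
  field_simp
end

section
/- Let p : ℝⁿ → ℝ be continuously differentiable with p(x) > 0 for all x, let q : ℝⁿ → ℝ be a (measurable, nonnegative, integrable) probability density, and let φ : ℝⁿ → ℝⁿ be a continuously differentiable vector field with compact support. For ε ∈ ℝ define the perturbed transform T_ε(x) = x + ε·φ(x) and G(ε) = ∫_{ℝⁿ} q(x)·[log p(x) − log p(T_ε(x)) − log|det(I + ε·Dφ(x))|] dx (the integrand vanishes outside the support of φ). Then there is ε₀ > 0 such that for all |ε| < ε₀ the determinant det(I + ε·Dφ(x)) is positive for every x and G(ε) is well defined, and G is differentiable at ε = 0 with G′(0) = −∫_{ℝⁿ} q(x)·[⟨∇ log p(x), φ(x)⟩ + trace(Dφ(x))] dx. -/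
open MeasureTheory

open Set Filter Topology

section Determinant

variable {E : Type*} [NormedAddCommGroup E] [NormedSpace ℝ E] [FiniteDimensional ℝ E]

theorem ContinuousLinearMap.contDiff_det_real {m : WithTop ℕ∞} :
    ContDiff ℝ m fun A : E →L[ℝ] E => A.det := by
  classical
  let b := Module.finBasis ℝ E
  have h : (fun A : E →L[ℝ] E => A.det) = fun A : E →L[ℝ] E =>
      (LinearMap.toMatrix b b A.toLinearMap).det := by
    ext A
    rw [LinearMap.det_toMatrix, ContinuousLinearMap.det]
  simp only [h, Matrix.det_apply]
  refine ContDiff.sum fun σ _ => ContDiff.const_smul _ (contDiff_prod fun i _ => ?_)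
  have := (LinearMap.toContinuousLinearMap (b.coord (σ i))).contDiff (n := m) |>.comp
    ((contDiff_id (𝕜 := ℝ) (E := E →L[ℝ] E)).clm_apply (contDiff_const (c := b i)))
  simpa [LinearMap.toMatrix_apply, Function.comp_def] using this

theorem ContinuousLinearMap.hasDerivAt_det_one_add_smul_zero (A : E →L[ℝ] E) :
    HasDerivAt (fun ε : ℝ => ((1 : E →L[ℝ] E) + ε • A).det)
      (LinearMap.trace ℝ E A.toLinearMap) 0 := by
  classical
  let b := Module.finBasis ℝ E
  let M := LinearMap.toMatrix b b A.toLinearMap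
  have h : (fun ε : ℝ => ((1 : E →L[ℝ] E) + ε • A).det) = fun ε => (1 + ε • M).det := by
    ext ε
    rw [ContinuousLinearMap.det, ← LinearMap.det_toMatrix b]
    congr 1
    have : (((1 : E →L[ℝ] E) + ε • A : E →L[ℝ] E) : E →ₗ[ℝ] E)
        = LinearMap.id + ε • A.toLinearMap := rfl
    rw [this, map_add, map_smul, LinearMap.toMatrix_id]
  rw [h, LinearMap.trace_eq_matrix_trace ℝ b]
  rw [funext fun ε : ℝ => Matrix.det_one_add_smul ε M]
  have h1 := ((hasDerivAt_id (0 : ℝ)).const_mul M.trace).const_add 1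
  have h2 := (Polynomial.hasDerivAt
    (Matrix.det (1 + (Polynomial.X : Polynomial ℝ) • M.map Polynomial.C)).divX.divX
    (0 : ℝ)).mul ((hasDerivAt_id (0 : ℝ)).pow 2)
  convert! h1.add h2 using 1
  simp [M]

theorem ContinuousLinearMap.hasDerivAt_det_one_add_smul (A : E →L[ℝ] E) (ε : ℝ) :
    HasDerivAt (fun ε : ℝ => ((1 : E →L[ℝ] E) + ε • A).det)
      (fderiv ℝ (fun B : E →L[ℝ] E => B.det) (1 + ε • A) A) ε := by
  have h := ((hasDerivAt_id ε).smul_const A).const_add (1 : E →L[ℝ] E)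
  simp only [id, one_smul] at h
  exact ((contDiff_det_real (m := 1)).differentiable one_ne_zero _).hasFDerivAt.comp_hasDerivAt
    ε h

end Determinant

/-- Differentiation under the integral sign against an integrable weight, for an integrand which
is continuous together with its derivative and vanishes off a compact set. -/
theorem hasDerivAt_integral_mul_of_compact {X : Type*} [TopologicalSpace X] [MeasurableSpace X]
    [OpensMeasurableSpace X] {μ : Measure X} {q : X → ℝ} (hq : Integrable q μ)
    {K : Set X} (hK : IsCompact K) {r : ℝ} (hr : 0 < r) {f g : ℝ → X → ℝ}
    (hf : ContinuousOn (Function.uncurry f) (Icc (-r) r ×ˢ univ))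
    (hg : ContinuousOn (Function.uncurry g) (Icc (-r) r ×ˢ univ))
    (hfK : ∀ ε, ∀ x ∉ K, f ε x = 0) (hgK : ∀ ε, ∀ x ∉ K, g ε x = 0)
    (hfg : ∀ ε ∈ Icc (-r) r, ∀ x, HasDerivAt (fun ε => f ε x) (g ε x) ε) :
    (∀ ε ∈ Icc (-r) r, Integrable (fun x => q x * f ε x) μ) ∧
      HasDerivAt (fun ε => ∫ x, q x * f ε x ∂μ) (∫ x, q x * g 0 x ∂μ) 0 := by
  have slice : ∀ {h : ℝ → X → ℝ}, ContinuousOn (Function.uncurry h) (Icc (-r) r ×ˢ univ) →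
      ∀ ε ∈ Icc (-r) r, Continuous (h ε) := fun {h} hh ε hε =>
    hh.comp_continuous (f := fun x => (ε, x)) (by fun_prop) fun x => ⟨hε, mem_univ x⟩
  have bound : ∀ {h : ℝ → X → ℝ}, ContinuousOn (Function.uncurry h) (Icc (-r) r ×ˢ univ) →
      (∀ ε, ∀ x ∉ K, h ε x = 0) → ∃ C, ∀ ε ∈ Icc (-r) r, ∀ x, ‖h ε x‖ ≤ C := by
    intro h hh hz
    obtain ⟨C, hC⟩ := (isCompact_Icc.prod hK).exists_bound_of_continuousOn
      (hh.mono (prod_mono_right (subset_univ K)))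
    refine ⟨max C 0, fun ε hε x => ?_⟩
    by_cases hx : x ∈ K
    · exact (hC (ε, x) ⟨hε, hx⟩).trans (le_max_left _ _)
    · simp [hz ε x hx]
  have int : ∀ ε ∈ Icc (-r) r, Integrable (fun x => q x * f ε x) μ := by
    intro ε hε
    obtain ⟨C, hC⟩ := bound hf hfK
    exact hq.mul_bdd (c := C) (slice hf ε hε).aestronglyMeasurable (ae_of_all _ (hC ε hε))
  have h0 : (0 : ℝ) ∈ Icc (-r) r := ⟨by linarith, hr.le⟩
  have hnhds : Icc (-r) r ∈ 𝓝 (0 : ℝ) := Icc_mem_nhds (by linarith) hr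
  refine ⟨int, ?_⟩
  obtain ⟨C, hC⟩ := bound hg hgK
  refine (hasDerivAt_integral_of_dominated_loc_of_deriv_le (bound := fun x => ‖q x‖ * C)
    (F' := fun ε x => q x * g ε x) hnhds ?_ (int 0 h0) ?_ ?_ (hq.norm.mul_const C) ?_).2
  · filter_upwards [hnhds] with ε hε using (int ε hε).aestronglyMeasurable
  · exact hq.aestronglyMeasurable.mul (slice hg 0 h0).aestronglyMeasurable
  · refine ae_of_all _ fun x ε hε => ?_
    rw [norm_mul]
    exact mul_le_mul_of_nonneg_left (hC ε hε x) (norm_nonneg _)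
  · exact ae_of_all _ fun x ε hε => (hfg ε hε x).const_mul (q x)

theorem exists_forall_det_one_add_smul_pos {E : Type*} [NormedAddCommGroup E] [NormedSpace ℝ E]
    [FiniteDimensional ℝ E] {A : E → E →L[ℝ] E} (hA : Continuous A) {K : Set E}
    (hK : IsCompact K) (hAK : ∀ x ∉ K, A x = 0) :
    ∃ r > (0 : ℝ), ∀ ε ∈ Icc (-r) r, ∀ x, 0 < ((1 : E →L[ℝ] E) + ε • A x).det := by
  have hcont : Continuous fun z : ℝ × E => ((1 : E →L[ℝ] E) + z.1 • A z.2).det :=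
    ContinuousLinearMap.continuous_det.comp (by fun_prop)
  have hone : (1 : E →L[ℝ] E).det = 1 := LinearMap.det_id
  have hev : ∀ᶠ ε in 𝓝 (0 : ℝ), ∀ x ∈ K, 0 < ((1 : E →L[ℝ] E) + ε • A x).det :=
    hK.eventually_forall_of_forall_eventually fun x _ =>
      hcont.continuousAt.eventually_const_lt (by simp [hone])
  obtain ⟨r, hr, h⟩ := Metric.nhds_basis_closedBall.eventually_iff.1 hev
  rw [Real.closedBall_eq_Icc, zero_sub, zero_add] at h
  refine ⟨r, hr, fun ε hε x => ?_⟩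
  by_cases hx : x ∈ K
  · exact h hε x hx
  · simp [hAK x hx, hone]

/-- The derivative of the KL divergence under an incremental transform, on a finite-dimensional
space and with respect to an arbitrary reference measure. -/
theorem exists_hasDerivAt_integral_log_transform {E : Type*} [NormedAddCommGroup E]
    [NormedSpace ℝ E] [FiniteDimensional ℝ E] [MeasurableSpace E] [BorelSpace E] {μ : Measure E}
    {p q : E → ℝ} (hp : ContDiff ℝ 1 p) (hppos : ∀ x, 0 < p x) (hqint : Integrable q μ)
    {φ : E → E} (hφ : ContDiff ℝ 1 φ) (hφsupp : HasCompactSupport φ) :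
    ∃ r > (0 : ℝ),
      (∀ ε : ℝ, |ε| < r →
        (∀ x, 0 < ((1 : E →L[ℝ] E) + ε • fderiv ℝ φ x).det) ∧
        Integrable (fun x => q x * (Real.log (p x) - Real.log (p (x + ε • φ x)) -
          Real.log |((1 : E →L[ℝ] E) + ε • fderiv ℝ φ x).det|)) μ) ∧
      HasDerivAt
        (fun ε : ℝ => ∫ x, q x * (Real.log (p x) - Real.log (p (x + ε • φ x)) -
          Real.log |((1 : E →L[ℝ] E) + ε • fderiv ℝ φ x).det|) ∂μ)
        (-∫ x, q x * (fderiv ℝ p x (φ x) / p x +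
            LinearMap.trace ℝ E (fderiv ℝ φ x).toLinearMap) ∂μ)
        0 := by
  have hDφ : Continuous (fderiv ℝ φ) := hφ.continuous_fderiv one_ne_zero
  have hφK : ∀ x ∉ tsupport φ, φ x = 0 := fun x hx => image_eq_zero_of_notMem_tsupport hx
  have hDK : ∀ x ∉ tsupport φ, fderiv ℝ φ x = 0 := fun x hx => by
    by_contra h
    exact hx (support_fderiv_subset ℝ h)
  obtain ⟨r, hr, hpos⟩ := exists_forall_det_one_add_smul_pos hDφ hφsupp.isCompact hDK
  let J : ℝ → E → E →L[ℝ] E := fun ε x => 1 + ε • fderiv ℝ φ x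
  let f : ℝ → E → ℝ := fun ε x => Real.log (p x) - Real.log (p (x + ε • φ x)) -
    Real.log |(J ε x).det|
  let g : ℝ → E → ℝ := fun ε x => -(fderiv ℝ p (x + ε • φ x) (φ x) / p (x + ε • φ x)) -
    fderiv ℝ (fun B : E →L[ℝ] E => B.det) (J ε x) (fderiv ℝ φ x) / (J ε x).det
  have hone : (1 : E →L[ℝ] E).det = 1 := LinearMap.det_id
  have hφc := hφ.continuous
  have hpc := hp.continuous
  have hJ : Continuous fun z : ℝ × E => J z.1 z.2 := by fun_prop
  have hdet : Continuous fun z : ℝ × E => (J z.1 z.2).det :=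
    ContinuousLinearMap.continuous_det.comp hJ
  have hT : Continuous fun z : ℝ × E => z.2 + z.1 • φ z.2 := by fun_prop
  have hf : ContinuousOn (Function.uncurry f) (Icc (-r) r ×ˢ univ) := by
    refine ContinuousOn.sub (Continuous.continuousOn (.sub ?_ ?_)) ?_
    · exact (hpc.comp continuous_snd).log fun z => (hppos _).ne'
    · exact (hpc.comp hT).log fun z => (hppos _).ne'
    · exact hdet.abs.continuousOn.log fun z hz => (abs_pos.2 (hpos z.1 hz.1 z.2).ne').ne'
  have hg : ContinuousOn (Function.uncurry g) (Icc (-r) r ×ˢ univ) := by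
    refine ContinuousOn.sub (Continuous.continuousOn (.neg (.div ?_ ?_ ?_))) (.div ?_ ?_ ?_)
    · exact ((hp.continuous_fderiv one_ne_zero).comp hT).clm_apply (hφc.comp continuous_snd)
    · exact hpc.comp hT
    · exact fun z => (hppos _).ne'
    · exact (((ContinuousLinearMap.contDiff_det_real.continuous_fderiv one_ne_zero).comp
        hJ).clm_apply (hDφ.comp continuous_snd)).continuousOn
    · exact hdet.continuousOn
    · exact fun z hz => (hpos z.1 hz.1 z.2).ne'
  have hfg : ∀ ε ∈ Icc (-r) r, ∀ x, HasDerivAt (fun ε => f ε x) (g ε x) ε := by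
    intro ε hε x
    have hline : HasDerivAt (fun ε : ℝ => x + ε • φ x) (φ x) ε := by
      simpa using ((hasDerivAt_id ε).smul_const (φ x)).const_add x
    have h1 := (((hp.differentiable one_ne_zero _).hasFDerivAt.comp_hasDerivAt ε hline).log
      (hppos _).ne').const_sub (Real.log (p x))
    have h2 := ((fderiv ℝ φ x).hasDerivAt_det_one_add_smul ε).log (hpos ε hε x).ne'
    simpa only [f, g, J, Real.log_abs] using! h1.sub h2
  obtain ⟨hint, hderiv⟩ := hasDerivAt_integral_mul_of_compact hqint hφsupp.isCompact hr hf hg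
    (fun ε x hx => by simp [f, J, hφK x hx, hDK x hx, hone])
    (fun ε x hx => by simp [g, hφK x hx, hDK x hx]) hfg
  refine ⟨r, hr, fun ε hε => ?_, ?_⟩
  · have hε' : ε ∈ Icc (-r) r := abs_le.1 hε.le
    exact ⟨hpos ε hε', hint ε hε'⟩
  · convert! hderiv using 1
    rw [← integral_neg]
    refine integral_congr_ae (ae_of_all _ fun x => ?_)
    have htr := ((fderiv ℝ φ x).hasDerivAt_det_one_add_smul 0).unique
      (fderiv ℝ φ x).hasDerivAt_det_one_add_smul_zero
    simp only [g, J, htr]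
    simp only [zero_smul, add_zero, hone, div_one]
    ring

/-- **Derivative of the KL divergence under an incremental transform
(the key lemma of Stein variational gradient descent).**
Let `p : ℝⁿ → ℝ` be `C¹` and positive, `q` a nonnegative integrable probability density,
and `φ` a `C¹` compactly supported vector field. With `T_ε(x) = x + ε φ(x)` and
`G(ε) = ∫ q(x) (log p(x) − log p(T_ε x) − log |det (I + ε Dφ(x))|) dx`
(which equals `KL(q_[T_ε] ‖ p) − KL(q ‖ p)`), there is `ε₀ > 0` such that for `|ε| < ε₀`
the determinant is positive everywhere and `G` is well defined, and `G` is differentiable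
at `0` with `G′(0) = −∫ q(x) (⟨∇ log p(x), φ(x)⟩ + trace (Dφ(x))) dx`. -/
theorem stein_kl_derivative {n : ℕ}
    (p : EuclideanSpace ℝ (Fin n) → ℝ) (hp : ContDiff ℝ 1 p) (hppos : ∀ x, 0 < p x)
    (q : EuclideanSpace ℝ (Fin n) → ℝ) (hqmeas : Measurable q) (hqnn : ∀ x, 0 ≤ q x)
    (hqint : Integrable q) (hqone : ∫ x, q x = 1)
    (φ : EuclideanSpace ℝ (Fin n) → EuclideanSpace ℝ (Fin n))
    (hφ : ContDiff ℝ 1 φ) (hφsupp : HasCompactSupport φ) :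
    ∃ ε₀ > (0 : ℝ),
      (∀ ε : ℝ, |ε| < ε₀ →
        (∀ x, 0 < ContinuousLinearMap.det
            ((1 : EuclideanSpace ℝ (Fin n) →L[ℝ] EuclideanSpace ℝ (Fin n)) +
              ε • fderiv ℝ φ x)) ∧
        Integrable (fun x => q x *
          (Real.log (p x) - Real.log (p (x + ε • φ x)) -
            Real.log |ContinuousLinearMap.det
              ((1 : EuclideanSpace ℝ (Fin n) →L[ℝ] EuclideanSpace ℝ (Fin n)) +
                ε • fderiv ℝ φ x)|))) ∧
      HasDerivAt
        (fun ε : ℝ => ∫ x, q x *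
          (Real.log (p x) - Real.log (p (x + ε • φ x)) -
            Real.log |ContinuousLinearMap.det
              ((1 : EuclideanSpace ℝ (Fin n) →L[ℝ] EuclideanSpace ℝ (Fin n)) +
                ε • fderiv ℝ φ x)|))
        (-∫ x, q x * (fderiv ℝ p x (φ x) / p x +
            LinearMap.trace ℝ (EuclideanSpace ℝ (Fin n)) (fderiv ℝ φ x).toLinearMap))
        0 :=
  exists_hasDerivAt_integral_log_transform hp hppos hqint hφ hφsupp
end
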